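/- Let (A, d) be a cochain complex and h a degree −1 map with h² = 0 and h d h = −h. Set B := ker(hd) ∩ ker(dh), let ψ : B ↪ A be the inclusion and φ : A → B, φ(a) = a + h(da) + d(ha). Then (φ, ψ, h) is a contraction: φ∘ψ = id_B, ψ∘φ − id_A = d∘h + h∘d, and the side conditions hold: φ∘h = 0, h∘ψ = 0, h² = 0. -/

import Mathlib

/-- The projection `φ := id + h∘d + d∘h` in degree `i+1`. -/
def phiMap {A : ℤ → Type*} [∀ i, AddCommGroup (A i)] [∀ i, Module ℝ (A i)]
    (d : ∀ i, A i →ₗ[ℝ] A (i + 1)) (h : ∀ i, A (i + 1) →ₗ[ℝ] A i) (i : ℤ) :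
    A (i + 1) →ₗ[ℝ] A (i + 1) :=
  LinearMap.id + (h (i + 1)).comp (d (i + 1)) + (d i).comp (h i)

/-- The subcomplex `B := ker(h∘d) ∩ ker(d∘h)` in degree `i+1`. -/
def kerB {A : ℤ → Type*} [∀ i, AddCommGroup (A i)] [∀ i, Module ℝ (A i)]
    (d : ∀ i, A i →ₗ[ℝ] A (i + 1)) (h : ∀ i, A (i + 1) →ₗ[ℝ] A i) (i : ℤ) :
    Submodule ℝ (A (i + 1)) :=
  LinearMap.ker ((h (i + 1)).comp (d (i + 1))) ⊓ LinearMap.ker ((d i).comp (h i))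

/-- **Lemma (contraction).** Let `(A, d)` be a cochain complex and `h` a degree `−1`
map with `h² = 0` and `h d h = −h`. Set `B := ker(hd) ∩ ker(dh)`, let `ψ : B ↪ A`
be the inclusion and `φ(a) = a + h(da) + d(ha)`. Then `(φ, ψ, h)` is a
contraction: `φ` and `ψ` are cochain maps, `φ∘ψ = id_B`,
`ψ∘φ − id_A = d∘h + h∘d`, and the side conditions `φ∘h = 0`, `h∘ψ = 0`,
`h² = 0` hold. -/
theorem statement_11 {A : ℤ → Type*} [∀ i, AddCommGroup (A i)] [∀ i, Module ℝ (A i)]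
    (d : ∀ i, A i →ₗ[ℝ] A (i + 1)) (h : ∀ i, A (i + 1) →ₗ[ℝ] A i)
    (hd2 : ∀ i, (d (i + 1)).comp (d i) = 0)
    (hh2 : ∀ i, (h i).comp (h (i + 1)) = 0)
    (hdh : ∀ i, (h i).comp ((d i).comp (h i)) = -(h i)) :
    ∀ i,
      -- φ takes values in B and is a cochain map
      (∀ a : A (i + 1), phiMap d h i a ∈ kerB d h i) ∧
      (∀ a : A (i + 1), d (i + 1) (phiMap d h i a) = phiMap d h (i + 1) (d (i + 1) a)) ∧
      -- ψ (the inclusion of B) is a cochain map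
      (∀ b ∈ kerB d h i, d (i + 1) b ∈ kerB d h (i + 1)) ∧
      -- φ ∘ ψ = id_B
      (∀ b ∈ kerB d h i, phiMap d h i b = b) ∧
      -- ψ ∘ φ − id_A = d∘h + h∘d
      (∀ a : A (i + 1), phiMap d h i a - a = d i (h i a) + h (i + 1) (d (i + 1) a)) ∧
      -- side conditions: φ ∘ h = 0, h ∘ ψ = 0, h² = 0
      (∀ x : A (i + 1 + 1), phiMap d h i (h (i + 1) x) = 0) ∧
      (∀ b ∈ kerB d h i, h i b = 0) ∧
      ((h i).comp (h (i + 1)) = 0) := by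
  have D : ∀ i x, d (i + 1) (d i x) = 0 := fun i x => LinearMap.congr_fun (hd2 i) x
  have H : ∀ i x, h i (h (i + 1) x) = 0 := fun i x => LinearMap.congr_fun (hh2 i) x
  have K : ∀ i x, h i (d i (h i x)) = -(h i x) := fun i x => LinearMap.congr_fun (hdh i) x
  have M : ∀ i b, b ∈ kerB d h i ↔ h (i + 1) (d (i + 1) b) = 0 ∧ d i (h i b) = 0 := by
    intro i b
    simp [kerB]
  have P : ∀ i a, phiMap d h i a = a + h (i + 1) (d (i + 1) a) + d i (h i a) := by
    intro i a
    simp [phiMap]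
  intro i
  refine ⟨?_, ?_, ?_, ?_, ?_, ?_, ?_, hh2 i⟩
  · intro a
    rw [M, P]
    simp [D, H, K]
  · intro a
    rw [P, P]
    simp [D]
  · intro b hb
    rw [M] at hb ⊢
    simp [D, hb.1]
  · intro b hb
    rw [M] at hb
    simp [P, hb.1, hb.2]
  · intro a
    rw [P]
    abel
  · intro x
    rw [P]
    simp [H, K]
  · intro b hb
    rw [M] at hb
    have := K i b
    rw [hb.2, map_zero] at this
    exact neg_eq_zero.mp this.symm
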